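/- arXiv:2112.15526 — 2 statements merged into one kernel-verified Lean document; each statement's English description precedes it below -/
import Mathlib

section
/- Let U ⊆ ℂ be a nonempty connected open set, c ∈ ℝ, and let K : U → ℝ be infinitely differentiable with K₂ < K(z) < K₁ and K(z) ≠ c for all z ∈ U, satisfying ∂K/∂x = μ(K)²/2 and ∂K/∂y = 0 on U. Then there is no infinitely differentiable, nowhere-vanishing function h : U → ℂ satisfying on all of U the two equations ∂h/∂z̄ = −(μ'(K)·μ(K)/4)·h and ∂h/∂z = (3·μ'(K)·μ(K)/4)·h + (μ(K)²/(4(K−c)))·h. (Local coordinate version of Lemma 3.3: no function h satisfies the conditions produced in Lemma 3.2.) -/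
/-- The function `μ(t) = √(−(4/3)(t−K₁)(t−K₂)(t+K₁+K₂))`. -/
noncomputable def mu (K₁ K₂ t : ℝ) : ℝ :=
  Real.sqrt (-(4 / 3) * (t - K₁) * (t - K₂) * (t + K₁ + K₂))

/-- The Wirtinger derivative `∂f/∂z = (1/2)(∂f/∂x − i ∂f/∂y)`. -/
noncomputable def wirtingerDz (f : ℂ → ℂ) (z : ℂ) : ℂ :=
  (1 / 2) * (fderiv ℝ f z 1 - Complex.I * fderiv ℝ f z Complex.I)

/-- The conjugate Wirtinger derivative `∂f/∂z̄ = (1/2)(∂f/∂x + i ∂f/∂y)`. -/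
noncomputable def wirtingerDzBar (f : ℂ → ℂ) (z : ℂ) : ℂ :=
  (1 / 2) * (fderiv ℝ f z 1 + Complex.I * fderiv ℝ f z Complex.I)

/-- The radicand of `mu`, with the roots `K₁`, `K₂`, `-(K₁ + K₂)` multiplied out. -/
lemma mu_radicand_eq (K₁ K₂ t : ℝ) :
    -(4 / 3) * (t - K₁) * (t - K₂) * (t + K₁ + K₂) =
      -(4 / 3) * (t ^ 3 - (K₁ ^ 2 + K₁ * K₂ + K₂ ^ 2) * t + K₁ * K₂ * (K₁ + K₂)) := by
  ring

lemma mu_radicand_pos {K₁ K₂ t : ℝ} (hK₂ : -(K₁ + K₂) ≤ K₂) (ht₂ : K₂ < t) (ht₁ : t < K₁) :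
    0 < -(4 / 3) * (t ^ 3 - (K₁ ^ 2 + K₁ * K₂ + K₂ ^ 2) * t + K₁ * K₂ * (K₁ + K₂)) := by
  rw [← mu_radicand_eq]
  have h : 0 < (K₁ - t) * (t - K₂) * (t + K₁ + K₂) :=
    mul_pos (mul_pos (by linarith) (by linarith)) (by linarith)
  linarith

lemma mu_sq {K₁ K₂ t : ℝ} (hK₂ : -(K₁ + K₂) ≤ K₂) (ht₂ : K₂ < t) (ht₁ : t < K₁) :
    mu K₁ K₂ t ^ 2 =
      -(4 / 3) * (t ^ 3 - (K₁ ^ 2 + K₁ * K₂ + K₂ ^ 2) * t + K₁ * K₂ * (K₁ + K₂)) := by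
  rw [mu, mu_radicand_eq, Real.sq_sqrt (mu_radicand_pos hK₂ ht₂ ht₁).le]

lemma hasDerivAt_mu_radicand (K₁ K₂ t : ℝ) :
    HasDerivAt (fun t : ℝ ↦
      -(4 / 3) * (t ^ 3 - (K₁ ^ 2 + K₁ * K₂ + K₂ ^ 2) * t + K₁ * K₂ * (K₁ + K₂)))
      (-(4 / 3) * (3 * t ^ 2 - (K₁ ^ 2 + K₁ * K₂ + K₂ ^ 2))) t := by
  have h := ((((hasDerivAt_id t).pow 3).sub
    ((hasDerivAt_id t).const_mul (K₁ ^ 2 + K₁ * K₂ + K₂ ^ 2))).add_const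
      (K₁ * K₂ * (K₁ + K₂))).const_mul (-(4 / 3) : ℝ)
  refine h.congr_deriv ?_
  simp

lemma deriv_mu_mul_mu {K₁ K₂ t : ℝ} (hK₂ : -(K₁ + K₂) ≤ K₂) (ht₂ : K₂ < t) (ht₁ : t < K₁) :
    deriv (mu K₁ K₂) t * mu K₁ K₂ t =
      -(2 / 3) * (3 * t ^ 2 - (K₁ ^ 2 + K₁ * K₂ + K₂ ^ 2)) := by
  have hpos := mu_radicand_pos hK₂ ht₂ ht₁
  have hmu : mu K₁ K₂ = fun t ↦ √(-(4 / 3) *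
      (t ^ 3 - (K₁ ^ 2 + K₁ * K₂ + K₂ ^ 2) * t + K₁ * K₂ * (K₁ + K₂))) := by
    funext t
    rw [mu, mu_radicand_eq]
  rw [hmu, ((hasDerivAt_mu_radicand K₁ K₂ t).sqrt hpos.ne').deriv]
  have hsqrt := (Real.sqrt_pos.2 hpos).ne'
  beta_reduce
  generalize √_ = s at hsqrt ⊢
  field_simp
  ring

/-- Integrability condition: if `∂h/∂x = S h` and `∂h/∂y = i D h` near `z` with `S`, `D` real
and `h z ≠ 0`, then `∂D/∂x = 0` at `z`. -/
lemma fderiv_one_eq_zero_of_logarithmic_derivatives {h : ℂ → ℂ} {S D : ℂ → ℝ} {z : ℂ}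
    (hh : ContDiffAt ℝ 2 h z) (hz : h z ≠ 0)
    (hS : DifferentiableAt ℝ S z) (hD : DifferentiableAt ℝ D z)
    (hx : ∀ᶠ w in nhds z, fderiv ℝ h w 1 = (S w : ℂ) * h w)
    (hy : ∀ᶠ w in nhds z, fderiv ℝ h w Complex.I = Complex.I * ((D w : ℂ) * h w)) :
    fderiv ℝ D z 1 = 0 := by
  have hdiff : DifferentiableAt ℝ (fderiv ℝ h) z :=
    (hh.fderiv_right (m := 1) (by norm_num)).differentiableAt (by norm_num)
  have hsymm := (hh.isSymmSndFDerivAt (by simp)) 1 Complex.I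
  have happly (v w : ℂ) :
      fderiv ℝ (fderiv ℝ h) z v w = fderiv ℝ (fun u ↦ fderiv ℝ h u w) z v := by
    rw [fderiv_clm_apply hdiff (differentiableAt_const w)]
    simp
  have hh' := (hh.differentiableAt (by norm_num)).hasFDerivAt
  have hS' := (Complex.ofRealCLM.hasFDerivAt.comp z hS.hasFDerivAt).mul hh'
  have hD' := ((Complex.ofRealCLM.hasFDerivAt.comp z hD.hasFDerivAt).mul hh').const_mul Complex.I
  have hS'' := hS'.congr_of_eventuallyEq (f₁ := fun u ↦ fderiv ℝ h u 1) hx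
  have hD'' := hD'.congr_of_eventuallyEq (f₁ := fun u ↦ fderiv ℝ h u Complex.I) hy
  rw [happly, happly, hS''.fderiv, hD''.fderiv] at hsymm
  simp only [add_apply, smul_apply,
    ContinuousLinearMap.comp_apply, Complex.ofRealCLM_apply, Function.comp_apply,
    smul_eq_mul, hx.self_of_nhds, hy.self_of_nhds] at hsymm
  have key : Complex.I * (fderiv ℝ D z 1 : ℂ) = (fderiv ℝ S z Complex.I : ℂ) := by
    apply mul_left_cancel₀ hz
    linear_combination hsymm
  simpa using congrArg Complex.im key

/-- A real cubic with nonzero leading coefficient has finitely many zeros. -/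
lemma finite_setOf_cubic_eq_zero {a : ℝ} (ha : a ≠ 0) (b c d : ℝ) :
    {t : ℝ | a * t ^ 3 + b * t ^ 2 + c * t + d = 0}.Finite := by
  have hne : (Cubic.mk a b c d).toPoly ≠ 0 := Cubic.ne_zero_of_a_ne_zero ha
  refine (Polynomial.finite_setOfPred_isRoot hne).subset fun t ht ↦ ?_
  simpa [Cubic.toPoly, Polynomial.IsRoot] using ht

/-- Local coordinate version of Lemma 3.3: there is no smooth
nowhere-vanishing `h` satisfying `∂h/∂z̄ = −(μ'(K)μ(K)/4) h` and
`∂h/∂z = (3μ'(K)μ(K)/4) h + (μ(K)²/(4(K−c))) h` on `U`. -/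
theorem no_function_h_as_in_lemma_3_2
    (K₁ K₂ : ℝ) (hK₁ : 0 < K₁) (hK₁₂ : K₂ < K₁) (hK₂ : -(K₁ + K₂) ≤ K₂)
    (c : ℝ) (U : Set ℂ) (hU : IsOpen U) (hUconn : IsConnected U)
    (K : ℂ → ℝ) (hK : ContDiffOn ℝ (⊤ : ℕ∞) K U)
    (hKrange : ∀ z ∈ U, K₂ < K z ∧ K z < K₁)
    (hKc : ∀ z ∈ U, K z ≠ c)
    (hKx : ∀ z ∈ U, fderiv ℝ K z 1 = (mu K₁ K₂ (K z)) ^ 2 / 2)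
    (hKy : ∀ z ∈ U, fderiv ℝ K z Complex.I = 0) :
    ¬ ∃ h : ℂ → ℂ, ContDiffOn ℝ (⊤ : ℕ∞) h U ∧ (∀ z ∈ U, h z ≠ 0) ∧
      (∀ z ∈ U, wirtingerDzBar h z =
        -(((deriv (mu K₁ K₂) (K z) * mu K₁ K₂ (K z) / 4 : ℝ) : ℂ)) * h z) ∧
      (∀ z ∈ U, wirtingerDz h z =
        ((3 * deriv (mu K₁ K₂) (K z) * mu K₁ K₂ (K z) / 4 : ℝ) : ℂ) * h z +
        (((mu K₁ K₂ (K z)) ^ 2 / (4 * (K z - c)) : ℝ) : ℂ) * h z) := by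
  rintro ⟨h, hh, hh0, hzbar, hz⟩
  set e : ℝ := K₁ ^ 2 + K₁ * K₂ + K₂ ^ 2 with he
  set r : ℝ := K₁ * K₂ * (K₁ + K₂) with hr
  have hKd : ∀ z ∈ U, DifferentiableAt ℝ K z := fun z hzU ↦
    (hK.contDiffAt (hU.mem_nhds hzU)).differentiableAt (by simp)
  have hKx_ne : ∀ z ∈ U, fderiv ℝ K z 1 ≠ 0 := fun z hzU ↦ by
    obtain ⟨h₂, h₁⟩ := hKrange z hzU
    rw [hKx z hzU, mu_sq hK₂ h₂ h₁]
    exact (half_pos (mu_radicand_pos hK₂ h₂ h₁)).ne'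
  have hcubic : ∀ z ∈ U,
      -(56 / 3) * K z ^ 3 + 36 * c * K z ^ 2 + -(16 * c ^ 2) * K z
        + (-(4 / 3) * e * c + 4 / 3 * r) = 0 := by
    intro z hzU
    have hc : K z - c ≠ 0 := sub_ne_zero.2 (hKc z hzU)
    -- `∂h/∂x = q h` for `a = 1 / 4` and `∂h/∂y = i q h` for `a = 1 / 2`, where `q` is
    -- `a · d(μ²)/dt + μ² / (4 (t - c))` at `t = K`.
    have hp (a : ℝ) : HasDerivAt (fun t : ℝ ↦
        a * (-(4 / 3) * (3 * t ^ 2 - e)) +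
          -(4 / 3) * (t ^ 3 - e * t + r) / (4 * (t - c)))
        (a * (-(4 / 3) * (6 * K z)) +
          (-(4 / 3) * (3 * K z ^ 2 - e) * (4 * (K z - c)) -
            -(4 / 3) * (K z ^ 3 - e * K z + r) * 4) / (4 * (K z - c)) ^ 2) (K z) := by
      have h₁ := (((((hasDerivAt_id (K z)).pow 2).const_mul 3).sub_const e).const_mul
        (-(4 / 3) : ℝ)).const_mul a
      have h₂ := (hasDerivAt_mu_radicand K₁ K₂ (K z)).div
        (((hasDerivAt_id (K z)).sub_const c).const_mul 4) (mul_ne_zero four_ne_zero hc)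
      refine (h₁.add h₂).congr_deriv ?_
      simp
      ring
    have hcomp (a : ℝ) := (hp a).comp_hasFDerivAt z (hKd z hzU).hasFDerivAt
    have hzero := fderiv_one_eq_zero_of_logarithmic_derivatives
      ((hh.contDiffAt (hU.mem_nhds hzU)).of_le (WithTop.coe_le_coe.2 (le_top : (2 : ℕ∞) ≤ ⊤))) (hh0 z hzU)
      (hcomp (1 / 4)).differentiableAt (hcomp (1 / 2)).differentiableAt ?_ ?_
    · rw [(hcomp (1 / 2)).fderiv] at hzero
      simp only [smul_apply, smul_eq_mul, mul_eq_zero,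
        hKx_ne z hzU, or_false] at hzero
      field_simp at hzero
      linear_combination (2 / 3) * hzero
    all_goals
      filter_upwards [hU.mem_nhds hzU] with w hw
      obtain ⟨h₂, h₁⟩ := hKrange w hw
      have hbar := hzbar w hw
      have hdz := hz w hw
      rw [mul_assoc 3, deriv_mu_mul_mu hK₂ h₂ h₁, mu_sq hK₂ h₂ h₁] at hdz
      rw [deriv_mu_mul_mu hK₂ h₂ h₁] at hbar
      simp only [wirtingerDz, wirtingerDzBar, ← he, ← hr] at hbar hdz
      simp only [Function.comp_apply]
      push_cast at hbar hdz ⊢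
    · linear_combination hbar + hdz
    · linear_combination Complex.I * (hdz - hbar) + fderiv ℝ h w Complex.I * Complex.I_sq
  have hfin : (K '' U).Finite :=
    (finite_setOf_cubic_eq_zero (by norm_num) _ _ _).subset (Set.image_subset_iff.2 hcubic)
  have hsub : (K '' U).Subsingleton := by
    by_contra hnt
    exact (hUconn.isPreconnected.image K hK.continuousOn).infinite_of_nontrivial
      (Set.not_subsingleton_iff.1 hnt) hfin
  obtain ⟨z, hzU⟩ := hUconn.nonempty
  have hconst : K =ᶠ[nhds z] fun _ ↦ K z := by
    filter_upwards [hU.mem_nhds hzU] with w hw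
    exact hsub (Set.mem_image_of_mem K hw) (Set.mem_image_of_mem K hzU)
  apply hKx_ne z hzU
  rw [hconst.fderiv_eq]
  simp
end

section
/- The function μ is twice differentiable on (K₂,K₁) and satisfies μ(t)·μ''(t) + (μ'(t))² = −4t for every t ∈ (K₂,K₁). -/
lemma radicand_pos {K₁ K₂ t : ℝ} (hK₂ : -(K₁ + K₂) ≤ K₂) (ht : t ∈ Set.Ioo K₂ K₁) :
    0 < -(4 / 3) * (t - K₁) * (t - K₂) * (t + K₁ + K₂) := by
  have h₁ : 0 < K₁ - t := sub_pos.2 ht.2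
  have h₂ : 0 < t - K₂ := sub_pos.2 ht.1
  have h₃ : 0 < t + K₁ + K₂ := by linarith
  have h := mul_pos (mul_pos h₁ h₂) h₃
  linarith

lemma hasDerivAt_mu {K₁ K₂ t : ℝ} (hK₂ : -(K₁ + K₂) ≤ K₂) (ht : t ∈ Set.Ioo K₂ K₁) :
    HasDerivAt (mu K₁ K₂)
      (-(4 / 3) * (3 * t ^ 2 - (K₁ ^ 2 + K₁ * K₂ + K₂ ^ 2)) / (2 * mu K₁ K₂ t)) t := by
  have hp : HasDerivAt (fun s : ℝ => -(4 / 3) * (s - K₁) * (s - K₂) * (s + K₁ + K₂))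
      (-(4 / 3) * (3 * t ^ 2 - (K₁ ^ 2 + K₁ * K₂ + K₂ ^ 2))) t := by
    have h := ((((hasDerivAt_id' t).sub_const K₁).const_mul (-(4 / 3))).mul
      ((hasDerivAt_id' t).sub_const K₂)).mul (((hasDerivAt_id' t).add_const K₁).add_const K₂)
    exact h.congr_deriv (by simp only [Pi.mul_apply]; ring)
  exact hp.sqrt (ne_of_gt (radicand_pos hK₂ ht))

/-- `μ` is twice differentiable on `(K₂,K₁)` and
`μ μ'' + (μ')² = −4t` there. -/
theorem mu_mul_second_deriv_mu
    (K₁ K₂ : ℝ) (hK₁ : 0 < K₁) (hK₁₂ : K₂ < K₁) (hK₂ : -(K₁ + K₂) ≤ K₂) :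
    ∀ t ∈ Set.Ioo K₂ K₁,
      DifferentiableAt ℝ (mu K₁ K₂) t ∧
      DifferentiableAt ℝ (deriv (mu K₁ K₂)) t ∧
      mu K₁ K₂ t * deriv (deriv (mu K₁ K₂)) t + (deriv (mu K₁ K₂) t) ^ 2 = -4 * t := by
  intro t ht
  have hμ : mu K₁ K₂ t ≠ 0 := (Real.sqrt_pos.2 (radicand_pos hK₂ ht)).ne'
  have h₁ := hasDerivAt_mu hK₂ ht
  have hq : HasDerivAt (fun s : ℝ => -(4 / 3) * (3 * s ^ 2 - (K₁ ^ 2 + K₁ * K₂ + K₂ ^ 2)))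
      (-8 * t) t := by
    have h := ((((hasDerivAt_id' t).pow 2).const_mul 3).sub_const
      (K₁ ^ 2 + K₁ * K₂ + K₂ ^ 2)).const_mul (-(4 / 3))
    exact h.congr_deriv (by norm_num; ring)
  have h₂ := (hq.div (h₁.const_mul 2) (mul_ne_zero two_ne_zero hμ)).congr_of_eventuallyEq
    (f₁ := deriv (mu K₁ K₂)) <| by
      filter_upwards [isOpen_Ioo.mem_nhds ht] with s hs using (hasDerivAt_mu hK₂ hs).deriv
  refine ⟨h₁.differentiableAt, h₂.differentiableAt, ?_⟩
  rw [h₂.deriv, h₁.deriv]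
  field_simp
  ring
end
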